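/- Let 0 < β < 1. Assume the core energies Q_GL and Q_{[1,0]}(β) exist, and assume that for each ε ∈ (0,1) there is a map u_ε, admissible for the scalar problem, with G_ε(u_ε) = I_GL(ε) and (1/ε²)·∫_{D₁}(1−|u_ε|²)² dx → 2π as ε → 0⁺. For each ε ∈ (0,1) let Ψ_ε be admissible with degrees (1,0) with E_ε(Ψ_ε) = I_{[1,0]}(ε;β), and let S_ε denote the spin of Ψ_ε. Then liminf_{ε→0⁺} (1/ε²)·∫_{D₁} S_ε² dx ≥ π/8. -/

import Mathlib

open MeasureTheory Metric Set Filter Complex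

noncomputable section

/-- Sum of squared norms of the two first-order partial derivatives (plane identified with `ℂ`). -/
def gradSq (f : ℂ → ℂ) (x : ℂ) : ℝ :=
  ‖fderiv ℝ f x 1‖ ^ 2 + ‖fderiv ℝ f x Complex.I‖ ^ 2

/-- Two-component Ginzburg–Landau energy density on the unit disk. -/
def eDen (ε β : ℝ) (ψp ψm : ℂ → ℂ) (x : ℂ) : ℝ :=
  (1 / 2) * (gradSq ψp x + gradSq ψm x)
    + (1 / (4 * ε ^ 2)) * ((‖ψp x‖ ^ 2 + ‖ψm x‖ ^ 2 - 1) ^ 2)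
    + (β / (4 * ε ^ 2)) * ((‖ψp x‖ ^ 2 - ‖ψm x‖ ^ 2) ^ 2)

/-- Two-component Ginzburg–Landau energy on the unit disk. -/
def En (ε β : ℝ) (ψp ψm : ℂ → ℂ) : ℝ := ∫ x in ball (0 : ℂ) 1, eDen ε β ψp ψm x

/-- Scalar Ginzburg–Landau energy density. -/
def gDen (ε : ℝ) (u : ℂ → ℂ) (x : ℂ) : ℝ :=
  (1 / 2) * gradSq u x + (1 / (4 * ε ^ 2)) * ((1 - ‖u x‖ ^ 2) ^ 2)

/-- Scalar Ginzburg–Landau energy on the unit disk. -/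
def Gn (ε : ℝ) (u : ℂ → ℂ) : ℝ := ∫ x in ball (0 : ℂ) 1, gDen ε u x

/-- Admissible two-component map with boundary degrees `(np, nm)`. -/
def AdmissiblePair (ε β : ℝ) (np nm : ℕ) (ψp ψm : ℂ → ℂ) : Prop :=
  ContinuousOn ψp (closedBall 0 1) ∧ ContinuousOn ψm (closedBall 0 1) ∧
  ContDiffOn ℝ 1 ψp (ball 0 1) ∧ ContDiffOn ℝ 1 ψm (ball 0 1) ∧
  IntegrableOn (eDen ε β ψp ψm) (ball 0 1) ∧
  ∀ x : ℂ, ‖x‖ = 1 →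
    ψp x = (Real.sqrt 2 : ℂ)⁻¹ * x ^ np ∧ ψm x = (Real.sqrt 2 : ℂ)⁻¹ * x ^ nm

/-- The infimum `I_{[np,nm]}(ε;β)`. -/
def Ival (ε β : ℝ) (np nm : ℕ) : ℝ :=
  sInf { e : ℝ | ∃ ψp ψm : ℂ → ℂ, AdmissiblePair ε β np nm ψp ψm ∧ e = En ε β ψp ψm }

/-- Admissible scalar map with degree-one boundary condition. -/
def AdmissibleScalar (ε : ℝ) (u : ℂ → ℂ) : Prop :=
  ContinuousOn u (closedBall 0 1) ∧ ContDiffOn ℝ 1 u (ball 0 1) ∧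
  IntegrableOn (gDen ε u) (ball 0 1) ∧ ∀ x : ℂ, ‖x‖ = 1 → u x = x

/-- The infimum `I_GL(ε)`. -/
def IGL (ε : ℝ) : ℝ :=
  sInf { e : ℝ | ∃ u : ℂ → ℂ, AdmissibleScalar ε u ∧ e = Gn ε u }

/-- Spin of a two-component map. -/
def spin (ψp ψm : ℂ → ℂ) (x : ℂ) : ℝ := (1 / 2) * (‖ψm x‖ ^ 2 - ‖ψp x‖ ^ 2)

theorem gradSq_nonneg (f : ℂ → ℂ) (x : ℂ) : 0 ≤ gradSq f x := by
  unfold gradSq; positivity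

theorem gradSq_const (c x : ℂ) : gradSq (fun _ => c) x = 0 := by
  simp [gradSq]

theorem gradSq_const_mul (c : ℂ) {f : ℂ → ℂ} {x : ℂ} (hf : DifferentiableAt ℝ f x) :
    gradSq (fun y => c * f y) x = ‖c‖ ^ 2 * gradSq f x := by
  have h : fderiv ℝ (fun y => c * f y) x = c • fderiv ℝ f x := fderiv_const_mul hf c
  simp only [gradSq, h, _root_.smul_apply, smul_eq_mul, norm_mul]
  ring

theorem differentiableAt_of_contDiffOn_ball {f : ℂ → ℂ} (hf : ContDiffOn ℝ 1 f (ball 0 1))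
    {x : ℂ} (hx : x ∈ ball (0 : ℂ) 1) : DifferentiableAt ℝ f x :=
  (hf.differentiableOn one_ne_zero).differentiableAt (isOpen_ball.mem_nhds hx)

theorem continuousOn_gradSq {f : ℂ → ℂ} (hf : ContDiffOn ℝ 1 f (ball 0 1)) :
    ContinuousOn (gradSq f) (ball 0 1) := by
  have h := hf.continuousOn_fderiv_of_isOpen isOpen_ball le_rfl
  exact ((h.clm_apply continuousOn_const).norm.pow 2).add
    ((h.clm_apply continuousOn_const).norm.pow 2)

theorem integrableOn_ball_of_continuousOn_closedBall {f : ℂ → ℝ}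
    (hf : ContinuousOn f (closedBall 0 1)) : IntegrableOn f (ball 0 1) :=
  (hf.integrableOn_compact (isCompact_closedBall 0 1)).mono_set ball_subset_closedBall

theorem AdmissiblePair.integrableOn_spin_sq {ε β : ℝ} {np nm : ℕ} {ψp ψm : ℂ → ℂ}
    (h : AdmissiblePair ε β np nm ψp ψm) :
    IntegrableOn (fun x => spin ψp ψm x ^ 2) (ball 0 1) := by
  obtain ⟨hp, hm, -⟩ := h
  exact integrableOn_ball_of_continuousOn_closedBall
    ((continuousOn_const.mul ((hm.norm.pow 2).sub (hp.norm.pow 2))).pow 2)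

theorem AdmissiblePair.integrableOn_gradSq {ε β : ℝ} {np nm : ℕ} {ψp ψm : ℂ → ℂ}
    (h : AdmissiblePair ε β np nm ψp ψm) : IntegrableOn (gradSq ψp) (ball 0 1) := by
  obtain ⟨hp, hm, hp', -, hi, -⟩ := h
  have h1 : IntegrableOn (fun x => (1 / (4 * ε ^ 2)) * ((‖ψp x‖ ^ 2 + ‖ψm x‖ ^ 2 - 1) ^ 2)
      + (β / (4 * ε ^ 2)) * ((‖ψp x‖ ^ 2 - ‖ψm x‖ ^ 2) ^ 2)) (ball 0 1) := by
    apply integrableOn_ball_of_continuousOn_closedBall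
    have := hp.norm
    have := hm.norm
    fun_prop
  have h2 := (hi.sub h1).const_mul 2
  refine Integrable.mono' h2
    ((continuousOn_gradSq hp').aestronglyMeasurable measurableSet_ball) (ae_of_all _ fun x => ?_)
  rw [Real.norm_of_nonneg (gradSq_nonneg _ _)]
  have := gradSq_nonneg ψm x
  simp only [Pi.sub_apply, eDen]
  linarith

theorem AdmissiblePair.admissibleScalar {ε β δ : ℝ} {nm : ℕ} {ψp ψm : ℂ → ℂ}
    (h : AdmissiblePair ε β 1 nm ψp ψm) :
    AdmissibleScalar δ (fun x => (Real.sqrt 2 : ℂ) * ψp x) := by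
  have hg := h.integrableOn_gradSq
  obtain ⟨hp, -, hp', -, -, hb⟩ := h
  have hc : ContinuousOn (fun x => (Real.sqrt 2 : ℂ) * ψp x) (closedBall 0 1) :=
    continuousOn_const.mul hp
  refine ⟨hc, contDiffOn_const.mul hp', ?_, fun x hx => ?_⟩
  · refine Integrable.add (Integrable.const_mul ?_ _) ?_
    · refine IntegrableOn.congr_fun (hg.const_mul (‖(Real.sqrt 2 : ℂ)‖ ^ 2)) (fun x hx => ?_)
        measurableSet_ball
      exact (gradSq_const_mul _ (differentiableAt_of_contDiffOn_ball hp' hx)).symm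
    · apply integrableOn_ball_of_continuousOn_closedBall
      have := hc.norm
      fun_prop
  · simp only [(hb x hx).1]
    have : (Real.sqrt 2 : ℂ) ≠ 0 := by simp
    field_simp

theorem norm_sqrt_two_sq : ‖(Real.sqrt 2 : ℂ)‖ ^ 2 = 2 := by
  rw [Complex.norm_real, Real.norm_of_nonneg (Real.sqrt_nonneg 2), Real.sq_sqrt zero_le_two]

theorem norm_sqrt_two_inv_sq : ‖(Real.sqrt 2 : ℂ)⁻¹‖ ^ 2 = 1 / 2 := by
  rw [norm_inv, inv_pow, norm_sqrt_two_sq, one_div]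

theorem gDen_nonneg (ε : ℝ) (u : ℂ → ℂ) (x : ℂ) : 0 ≤ gDen ε u x := by
  have := gradSq_nonneg u x
  unfold gDen; positivity

theorem eDen_nonneg {β : ℝ} (hβ : 0 ≤ β) (ε : ℝ) (ψp ψm : ℂ → ℂ) (x : ℂ) :
    0 ≤ eDen ε β ψp ψm x := by
  have := gradSq_nonneg ψp x
  have := gradSq_nonneg ψm x
  unfold eDen; positivity

theorem IGL_le_Gn {ε : ℝ} {u : ℂ → ℂ} (h : AdmissibleScalar ε u) : IGL ε ≤ Gn ε u := by
  refine csInf_le ⟨0, ?_⟩ ⟨u, h, rfl⟩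
  rintro _ ⟨v, -, rfl⟩
  exact integral_nonneg fun x => gDen_nonneg ε v x

theorem Ival_le_En {ε β : ℝ} (hβ : 0 ≤ β) {np nm : ℕ} {ψp ψm : ℂ → ℂ}
    (h : AdmissiblePair ε β np nm ψp ψm) : Ival ε β np nm ≤ En ε β ψp ψm := by
  refine csInf_le ⟨0, ?_⟩ ⟨ψp, ψm, h, rfl⟩
  rintro _ ⟨φp, φm, -, rfl⟩
  exact integral_nonneg fun x => eDen_nonneg hβ ε φp φm x

/-- A scalar map `u` gives the competitor `(u, 1) / √2`, whose energy is half the scalar energy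
at a rescaled length. -/
theorem Ival_le_half_Gn {ε β k : ℝ} (hβ : 0 ≤ β) (hk : k ^ 2 = 2 / (1 + β))
    {u : ℂ → ℂ} (hu : AdmissibleScalar (k * ε) u) :
    Ival ε β 1 0 ≤ 1 / 2 * Gn (k * ε) u := by
  obtain ⟨hc, hd, hi, hb⟩ := hu
  have key : ∀ x ∈ ball (0 : ℂ) 1,
      eDen ε β (fun y => (Real.sqrt 2 : ℂ)⁻¹ * u y) (fun _ => (Real.sqrt 2 : ℂ)⁻¹) x
        = 1 / 2 * gDen (k * ε) u x := by
    intro x hx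
    have hne : 1 + β ≠ 0 := by positivity
    simp only [eDen, gDen, gradSq_const_mul _ (differentiableAt_of_contDiffOn_ball hd hx),
      gradSq_const, norm_mul, mul_pow, norm_sqrt_two_inv_sq, hk]
    field_simp
    ring
  have hadm : AdmissiblePair ε β 1 0 (fun y => (Real.sqrt 2 : ℂ)⁻¹ * u y)
      (fun _ => (Real.sqrt 2 : ℂ)⁻¹) := by
    refine ⟨continuousOn_const.mul hc, continuousOn_const, contDiffOn_const.mul hd,
      contDiffOn_const, ?_, fun x hx => ⟨by simp [hb x hx], by simp⟩⟩
    exact IntegrableOn.congr_fun (hi.const_mul (1 / 2)) (fun x hx => (key x hx).symm)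
      measurableSet_ball
  refine (Ival_le_En hβ hadm).trans_eq ?_
  rw [En, Gn, setIntegral_congr_fun measurableSet_ball key, integral_const_mul]

/-- A pointwise comparison of the densities bounds the scalar infimum by the two-component
energy, up to a multiple of the squared spin. -/
theorem half_IGL_add_le_En {ε β δ c : ℝ} {nm : ℕ} {ψp ψm : ℂ → ℂ}
    (h : AdmissiblePair ε β 1 nm ψp ψm)
    (hc : ∀ a b : ℝ, 1 / (8 * δ ^ 2) * (1 - 2 * a) ^ 2 + c * (1 / 2 * (b - a)) ^ 2 ≤
      1 / (4 * ε ^ 2) * (a + b - 1) ^ 2 + β / (4 * ε ^ 2) * (a - b) ^ 2) :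
    1 / 2 * IGL δ + c * ∫ x in ball (0 : ℂ) 1, spin ψp ψm x ^ 2 ≤ En ε β ψp ψm := by
  have hs : AdmissibleScalar δ (fun x => (Real.sqrt 2 : ℂ) * ψp x) := h.admissibleScalar
  have hi : Integrable (fun x => 1 / 2 * gDen δ (fun x => (Real.sqrt 2 : ℂ) * ψp x) x)
      (volume.restrict (ball 0 1)) := hs.2.2.1.const_mul _
  have hi' : Integrable (fun x => c * spin ψp ψm x ^ 2) (volume.restrict (ball 0 1)) :=
    h.integrableOn_spin_sq.const_mul _
  calc 1 / 2 * IGL δ + c * ∫ x in ball (0 : ℂ) 1, spin ψp ψm x ^ 2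
      ≤ 1 / 2 * Gn δ (fun x => (Real.sqrt 2 : ℂ) * ψp x)
          + c * ∫ x in ball (0 : ℂ) 1, spin ψp ψm x ^ 2 := by
        gcongr
        exact IGL_le_Gn hs
    _ = ∫ x in ball (0 : ℂ) 1, (1 / 2 * gDen δ (fun x => (Real.sqrt 2 : ℂ) * ψp x) x
          + c * spin ψp ψm x ^ 2) := by
        rw [integral_add hi hi', integral_const_mul, integral_const_mul, Gn]
    _ ≤ En ε β ψp ψm := by
        refine setIntegral_mono_on (hi.add hi') h.2.2.2.2.1 measurableSet_ball fun x hx => ?_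
        have hd := differentiableAt_of_contDiffOn_ball h.2.2.1 hx
        have hn := gradSq_nonneg ψm x
        have hp := hc (‖ψp x‖ ^ 2) (‖ψm x‖ ^ 2)
        have he : 1 / (4 * δ ^ 2) * (1 - 2 * ‖ψp x‖ ^ 2) ^ 2
            = 2 * (1 / (8 * δ ^ 2) * (1 - 2 * ‖ψp x‖ ^ 2) ^ 2) := by ring
        simp only [gDen, eDen, spin, gradSq_const_mul _ hd, norm_mul, mul_pow, norm_sqrt_two_sq,
          he] at hp ⊢
        linarith

theorem tendsto_const_mul_nhdsGT_zero {k : ℝ} (hk : 0 < k) :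
    Tendsto (fun ε => k * ε) (nhdsWithin 0 (Ioi 0)) (nhdsWithin 0 (Ioi 0)) := by
  refine tendsto_nhdsWithin_iff.2 ⟨?_, ?_⟩
  · have : Tendsto (fun ε : ℝ => k * ε) (nhds 0) (nhds (k * 0)) := tendsto_id.const_mul k
    rw [mul_zero] at this
    exact this.mono_left nhdsWithin_le_nhds
  · filter_upwards [self_mem_nhdsWithin] with ε hε
    exact mul_pos hk hε

/-- Rescaling the length shifts a logarithmically divergent quantity by a constant. -/
theorem tendsto_sub_rescale {f : ℝ → ℝ} {a Q : ℝ}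
    (hf : Tendsto (fun ε => f ε - a * Real.log (1 / ε)) (nhdsWithin 0 (Ioi 0)) (nhds Q))
    {k l : ℝ} (hk : 0 < k) (hl : 0 < l) :
    Tendsto (fun ε => f (l * ε) - f (k * ε)) (nhdsWithin 0 (Ioi 0))
      (nhds (a * (Real.log k - Real.log l))) := by
  have h := ((hf.comp (tendsto_const_mul_nhdsGT_zero hl)).sub
    (hf.comp (tendsto_const_mul_nhdsGT_zero hk))).add_const (a * (Real.log k - Real.log l))
  rw [sub_self, zero_add] at h
  refine h.congr' ?_
  filter_upwards [self_mem_nhdsWithin] with ε hε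
  have hε' : ε ≠ 0 := (ne_of_gt hε)
  simp only [Function.comp, one_div, Real.log_inv, Real.log_mul hk.ne' hε',
    Real.log_mul hl.ne' hε']
  ring

/-- For `0 < β < 1`: if the core energies `Q_GL` and `Q_{[1,0]}(β)` exist, scalar
minimizers `u_ε` exist with `(1/ε²)∫(1−|u_ε|²)² → 2π`, and `Ψ_ε` are minimizers of
`I_{[1,0]}(ε;β)` with spins `S_ε`, then `liminf_{ε→0⁺}(1/ε²)∫ S_ε² ≥ π/8`. -/
theorem statement6 (β QGL Q10 : ℝ) (hβ0 : 0 < β) (hβ1 : β < 1)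
    (hQGL : Tendsto (fun ε => IGL ε - Real.pi * Real.log (1 / ε))
      (nhdsWithin 0 (Ioi 0)) (nhds QGL))
    (hQ10 : Tendsto (fun ε => Ival ε β 1 0 - (Real.pi / 2) * Real.log (1 / ε))
      (nhdsWithin 0 (Ioi 0)) (nhds Q10))
    (u : ℝ → ℂ → ℂ)
    (hu : ∀ ε ∈ Ioo (0 : ℝ) 1, AdmissibleScalar ε (u ε) ∧ Gn ε (u ε) = IGL ε)
    (huconv : Tendsto
      (fun ε => (1 / ε ^ 2) * ∫ x in ball (0 : ℂ) 1, (1 - ‖u ε x‖ ^ 2) ^ 2)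
      (nhdsWithin 0 (Ioi 0)) (nhds (2 * Real.pi)))
    (Ψp Ψm : ℝ → ℂ → ℂ)
    (hΨ : ∀ ε ∈ Ioo (0 : ℝ) 1,
      AdmissiblePair ε β 1 0 (Ψp ε) (Ψm ε) ∧ En ε β (Ψp ε) (Ψm ε) = Ival ε β 1 0) :
    Real.pi / 8 ≤
      Filter.liminf
        (fun ε => (1 / ε ^ 2) * ∫ x in ball (0 : ℂ) 1, (spin (Ψp ε) (Ψm ε) x) ^ 2)
        (nhdsWithin 0 (Ioi 0)) := by
  set F : ℝ → ℝ := fun ε =>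
    (1 / ε ^ 2) * ∫ x in ball (0 : ℂ) 1, (spin (Ψp ε) (Ψm ε) x) ^ 2 with hF
  set k : ℝ := √(2 / (1 + β)) with hk
  have hk0 : 0 < k := Real.sqrt_pos.2 (by positivity)
  have hk2 : k ^ 2 = 2 / (1 + β) := Real.sq_sqrt (by positivity)
  set l : ℝ := √(2 / β) with hl
  have hl0 : 0 < l := Real.sqrt_pos.2 (by positivity)
  have hl2 : l ^ 2 = 2 / β := Real.sq_sqrt (by positivity)
  have hsmall : ∀ᶠ ε : ℝ in nhdsWithin 0 (Ioi 0), ε ∈ Ioo (0 : ℝ) 1 :=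
    Ioo_mem_nhdsGT one_pos
  have hupper : ∀ᶠ ε : ℝ in nhdsWithin 0 (Ioi 0),
      En ε β (Ψp ε) (Ψm ε) ≤ 1 / 2 * IGL (k * ε) := by
    filter_upwards [hsmall, (tendsto_const_mul_nhdsGT_zero hk0).eventually hsmall] with ε hε hkε
    obtain ⟨hadm, hmin⟩ := hu _ hkε
    rw [(hΨ ε hε).2, ← hmin]
    exact Ival_le_half_Gn hβ0.le hk2 hadm
  have hlow : ∀ᶠ ε : ℝ in nhdsWithin 0 (Ioi 0),
      1 / (2 * (1 - β)) * (IGL (1 * ε) - IGL (k * ε)) ≤ F ε := by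
    filter_upwards [hsmall, hupper] with ε hε hup
    have hε0 : ε ≠ 0 := hε.1.ne'
    have h := half_IGL_add_le_En (δ := ε) (c := -(1 - β) / ε ^ 2) (hΨ ε hε).1 fun a b => by
      have : 1 / (4 * ε ^ 2) * (a + b - 1) ^ 2 + β / (4 * ε ^ 2) * (a - b) ^ 2
          - (1 / (8 * ε ^ 2) * (1 - 2 * a) ^ 2 + -(1 - β) / ε ^ 2 * (1 / 2 * (b - a)) ^ 2)
          = 1 / (8 * ε ^ 2) * (1 - 2 * b) ^ 2 := by
        field_simp
        ring
      have : 0 ≤ 1 / (8 * ε ^ 2) * (1 - 2 * b) ^ 2 := by positivity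
      linarith
    have hc : (-(1 - β) / ε ^ 2) * ∫ x in ball (0 : ℂ) 1, spin (Ψp ε) (Ψm ε) x ^ 2
        = -(1 - β) * F ε := by
      simp only [hF]; ring
    rw [hc] at h
    have h1 : 0 < 2 * (1 - β) := by linarith
    rw [one_mul, one_div, inv_mul_le_iff₀ h1]
    linarith
  have hbdd : ∀ᶠ ε : ℝ in nhdsWithin 0 (Ioi 0),
      F ε ≤ 1 / β * (IGL (k * ε) - IGL (l * ε)) := by
    filter_upwards [hsmall, hupper] with ε hε hup
    have hε0 : ε ≠ 0 := hε.1.ne'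
    have h := half_IGL_add_le_En (δ := l * ε) (c := β / 2 / ε ^ 2) (hΨ ε hε).1 fun a b => by
      have : 1 / (4 * ε ^ 2) * (a + b - 1) ^ 2 + β / (4 * ε ^ 2) * (a - b) ^ 2
          - (1 / (8 * (l * ε) ^ 2) * (1 - 2 * a) ^ 2 + β / 2 / ε ^ 2 * (1 / 2 * (b - a)) ^ 2)
          = (1 - β / 2) / (4 * ε ^ 2) * (a + b - 1) ^ 2
            + β / (16 * ε ^ 2) * (1 - 2 * b) ^ 2 := by
        rw [mul_pow, hl2]
        field_simp
        ring
      have h1 : 0 ≤ 1 - β / 2 := by linarith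
      have : 0 ≤ (1 - β / 2) / (4 * ε ^ 2) * (a + b - 1) ^ 2
          + β / (16 * ε ^ 2) * (1 - 2 * b) ^ 2 := by positivity
      linarith
    have hc : (β / 2 / ε ^ 2) * ∫ x in ball (0 : ℂ) 1, spin (Ψp ε) (Ψm ε) x ^ 2
        = β / 2 * F ε := by
      simp only [hF]; ring
    rw [hc] at h
    rw [one_div, le_inv_mul_iff₀ hβ0]
    linarith
  have hlim := (tendsto_sub_rescale hQGL hk0 one_pos).const_mul (1 / (2 * (1 - β)))
  have hlim' := (tendsto_sub_rescale hQGL hl0 hk0).const_mul (1 / β)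
  have hco : IsCoboundedUnder (· ≥ ·) (nhdsWithin (0 : ℝ) (Ioi 0)) F := by
    apply IsBoundedUnder.isCoboundedUnder_ge
    refine IsBoundedUnder.mono_le (hlim'.congr fun ε => ?_).isBoundedUnder_le hbdd
    ring
  refine le_trans ?_ (hlim.liminf_eq.symm.le.trans
    (liminf_le_liminf hlow hlim.isBoundedUnder_ge hco))
  have hlog : (1 - β) / 4 ≤ Real.log k := by
    have h1 := Real.one_sub_inv_le_log_of_pos (show 0 < k ^ 2 by positivity)
    rw [Real.log_pow, hk2, inv_div] at h1
    push_cast at h1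
    linarith
  have h1 : 0 < 2 * (1 - β) := by linarith
  rw [Real.log_one, sub_zero, one_div, le_inv_mul_iff₀ h1]
  nlinarith [Real.pi_pos]
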